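/- Let 𝕋² be the subspace of (Fin 3 → Fin 3 → Fin 3 → ℝ) consisting of T with T i j k = T j i k for all i, j, k, with SO(3) acting by (Q • T) i j k = ∑ p q r, Q i p * Q j q * Q k r * T p q r. The set of linear endomorphisms A of 𝕋² that are equivariant (A (Q • T) = Q • (A T) for all Q ∈ SO(3), T ∈ 𝕋²) is an ℝ-subalgebra of the endomorphism algebra of 𝕋², and this subalgebra is isomorphic, as an ℝ-algebra, to ℝ × ℝ × Matrix (Fin 2) (Fin 2) ℝ. -/

import Mathlib

open Matrix

/-- The space 𝕋² of third-order tensors symmetric in their first two indices. -/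
def T2 : Submodule ℝ (Fin 3 → Fin 3 → Fin 3 → ℝ) where
  carrier := {T | ∀ i j k, T i j k = T j i k}
  add_mem' := by
    intro a b ha hb i j k
    simp only [Pi.add_apply]
    rw [ha i j k, hb i j k]
  zero_mem' := by intro i j k; rfl
  smul_mem' := by
    intro c a ha i j k
    simp only [Pi.smul_apply, smul_eq_mul]
    rw [ha i j k]

/-- The action of a 3×3 matrix on third-order tensors. -/
def act (Q : Matrix (Fin 3) (Fin 3) ℝ) (T : Fin 3 → Fin 3 → Fin 3 → ℝ) :
    Fin 3 → Fin 3 → Fin 3 → ℝ :=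
  fun i j k => ∑ p : Fin 3, ∑ q : Fin 3, ∑ r : Fin 3, Q i p * Q j q * Q k r * T p q r

def Equi (B : Module.End ℝ ↥T2) : Prop :=
  ∀ Q : Matrix (Fin 3) (Fin 3) ℝ, Qᵀ * Q = 1 → Q.det = 1 →
    ∀ (T : T2) (h : act Q (T : Fin 3 → Fin 3 → Fin 3 → ℝ) ∈ T2),
      ((B ⟨act Q (T : Fin 3 → Fin 3 → Fin 3 → ℝ), h⟩ : T2) : Fin 3 → Fin 3 → Fin 3 → ℝ)
        = act Q ((B T : T2) : Fin 3 → Fin 3 → Fin 3 → ℝ)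

/-- Kronecker delta. -/
def dl (i j : Fin 3) : ℝ := if i = j then 1 else 0

/-- Spanning tensors of `T2`. -/
def E (p q r : Fin 3) : T2 :=
  ⟨fun i j k => (dl i p * dl j q + dl i q * dl j p) * dl k r, fun i j k => by ring⟩

/-- Components of an operator. -/
def cf (B : Module.End ℝ ↥T2) (i j k p q r : Fin 3) : ℝ := (B (E p q r)).1 i j k

lemma act_mem (Q : Matrix (Fin 3) (Fin 3) ℝ) (T : T2) : act Q T.1 ∈ T2 := by
  intro i j k
  simp only [act]
  rw [Finset.sum_comm]
  refine Finset.sum_congr rfl fun p _ => Finset.sum_congr rfl fun q _ =>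
    Finset.sum_congr rfl fun r _ => ?_
  rw [T.2 q p r]; ring

lemma act_E (Q : Matrix (Fin 3) (Fin 3) ℝ) (p q r : Fin 3) :
    (⟨act Q (E p q r).1, act_mem Q _⟩ : T2) =
      ∑ a, ∑ b, ∑ c, (Q a p * Q b q * Q c r) • E a b c := by
  apply Subtype.ext
  funext i j k
  simp only [act, E, Submodule.coe_sum, Submodule.coe_smul, Finset.sum_apply, Pi.smul_apply,
    smul_eq_mul, dl, mul_add, add_mul, Finset.sum_add_distrib]
  congr 1
  · simp
  · simp [mul_comm (Q i q)]

lemma E_span (T : T2) : T = ∑ p, ∑ q, ∑ r, ((1/2 : ℝ) * T.1 p q r) • E p q r := by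
  apply Subtype.ext
  funext i j k
  simp only [E, Submodule.coe_sum, Submodule.coe_smul, Finset.sum_apply, Pi.smul_apply,
    smul_eq_mul, dl, mul_add, add_mul, Finset.sum_add_distrib]
  simp
  rw [T.2 j i k]; ring

lemma star (B : Module.End ℝ ↥T2) (hB : Equi B) (Q : Matrix (Fin 3) (Fin 3) ℝ)
    (h1 : Qᵀ * Q = 1) (h2 : Q.det = 1) (i j k p q r : Fin 3) :
    ∑ a, ∑ b, ∑ c, Q a p * Q b q * Q c r * cf B i j k a b c =
      ∑ x, ∑ y, ∑ z, Q i x * Q j y * Q k z * cf B x y z p q r := by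
  have := hB Q h1 h2 (E p q r) (act_mem Q _)
  rw [act_E] at this
  simp only [map_sum, map_smul, Submodule.coe_sum, Submodule.coe_smul] at this
  have := congrFun (congrFun (congrFun this i) j) k
  simp only [Finset.sum_apply, Pi.smul_apply, smul_eq_mul] at this
  exact this

lemma starO (B : Module.End ℝ ↥T2) (hB : Equi B) (Q : Matrix (Fin 3) (Fin 3) ℝ)
    (h1 : Qᵀ * Q = 1) (i j k p q r : Fin 3) :
    ∑ a, ∑ b, ∑ c, Q a p * Q b q * Q c r * cf B i j k a b c =
      ∑ x, ∑ y, ∑ z, Q i x * Q j y * Q k z * cf B x y z p q r := by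
  have hd : Q.det * Q.det = 1 := by
    have := congrArg Matrix.det h1
    simpa using this
  rcases mul_self_eq_one_iff.mp hd with h | h
  · exact star B hB Q h1 h i j k p q r
  · have := star B hB (-Q) (by simpa using h1) (by norm_num [Matrix.det_neg, h]) i j k p q r
    simpa using this

lemma cf_perm (B : Module.End ℝ ↥T2) (hB : Equi B) (σ : Equiv.Perm (Fin 3))
    (i j k p q r : Fin 3) :
    cf B (σ i) (σ j) (σ k) (σ p) (σ q) (σ r) = cf B i j k p q r := by
  have := starO B hB (Matrix.of fun a p => if a = σ p then 1 else 0)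
    (by ext a b; simp [Matrix.mul_apply, Matrix.one_apply, eq_comm]) (σ i) (σ j) (σ k) p q r
  simpa using this

lemma cf_refl (B : Module.End ℝ ↥T2) (hB : Equi B) (s : Fin 3 → ℝ) (hs : ∀ a, s a * s a = 1)
    (i j k p q r : Fin 3) :
    s p * s q * s r * cf B i j k p q r = s i * s j * s k * cf B i j k p q r := by
  have := starO B hB (Matrix.diagonal s)
    (by simp [hs]) i j k p q r
  simpa [Matrix.diagonal_apply] using this

/-- swap of 0 and 1 -/
def fl : Fin 3 → Fin 3 := ![1, 0, 2]
/-- signs of the infinitesimal rotation -/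
def sg : Fin 3 → ℝ := ![1, -1, 0]

lemma cf_lie (B : Module.End ℝ ↥T2) (hB : Equi B) (i j k p q r : Fin 3) :
    sg i * cf B (fl i) j k p q r + sg j * cf B i (fl j) k p q r + sg k * cf B i j (fl k) p q r
    + sg p * cf B i j k (fl p) q r + sg q * cf B i j k p (fl q) r
    + sg r * cf B i j k p q (fl r) = 0 := by
  let Q : ℝ → Matrix (Fin 3) (Fin 3) ℝ := fun θ =>
    !![Real.cos θ, -Real.sin θ, 0; Real.sin θ, Real.cos θ, 0; 0, 0, 1]
  let X : Matrix (Fin 3) (Fin 3) ℝ := !![0, -1, 0; 1, 0, 0; 0, 0, 0]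
  have hQ0 : Q 0 = 1 := by
    ext a b; fin_cases a <;> fin_cases b <;> simp [Q]
  have hQ : ∀ a b, HasDerivAt (fun θ => Q θ a b) (X a b) 0 := by
    intro a b
    have hc := Real.hasDerivAt_cos 0
    have hs := Real.hasDerivAt_sin 0
    have hs' := hs.neg
    simp only [Real.sin_zero, Real.cos_zero, neg_zero] at hc hs hs'
    fin_cases a <;> fin_cases b <;> simp [Q, X] <;>
      first | exact hc | exact hs | exact hs' | exact hasDerivAt_const _ _
  have h1 : ∀ θ, (Q θ)ᵀ * Q θ = 1 := by
    intro θ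
    have := Real.sin_sq_add_cos_sq θ
    ext a b; fin_cases a <;> fin_cases b <;> simp [Q, Matrix.mul_apply, Fin.sum_univ_three] <;>
      linarith
  have hst := fun θ => starO B hB (Q θ) (h1 θ) i j k p q r
  have d1 : HasDerivAt (fun θ => ∑ a, ∑ b, ∑ c, Q θ a p * Q θ b q * Q θ c r * cf B i j k a b c)
      (∑ a, ∑ b, ∑ c, ((X a p * Q 0 b q + Q 0 a p * X b q) * Q 0 c r + Q 0 a p * Q 0 b q * X c r)
        * cf B i j k a b c) 0 :=
    HasDerivAt.fun_sum fun a _ => HasDerivAt.fun_sum fun b _ => HasDerivAt.fun_sum fun c _ =>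
      (((hQ a p).mul (hQ b q)).mul (hQ c r)).mul_const _
  have d2 : HasDerivAt (fun θ => ∑ x, ∑ y, ∑ z, Q θ i x * Q θ j y * Q θ k z * cf B x y z p q r)
      (∑ x, ∑ y, ∑ z, ((X i x * Q 0 j y + Q 0 i x * X j y) * Q 0 k z + Q 0 i x * Q 0 j y * X k z)
        * cf B x y z p q r) 0 :=
    HasDerivAt.fun_sum fun a _ => HasDerivAt.fun_sum fun b _ => HasDerivAt.fun_sum fun c _ =>
      (((hQ i a).mul (hQ j b)).mul (hQ k c)).mul_const _
  have e := (funext hst ▸ d1).unique d2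
  rw [hQ0] at e
  simp only [Matrix.one_apply, add_mul, Finset.sum_add_distrib] at e
  simp at e
  have X1 : ∀ (g : Fin 3 → ℝ) p, ∑ a, X a p * g a = sg p * g (fl p) := by
    intro g p; fin_cases p <;> simp [X, sg, fl, Fin.sum_univ_three]
  have X2 : ∀ (g : Fin 3 → ℝ) p, ∑ a, X p a * g a = - (sg p * g (fl p)) := by
    intro g p; fin_cases p <;> simp [X, sg, fl, Fin.sum_univ_three]
  have Y1 := X1 (fun a => cf B i j k a q r) p
  have Y2 := X1 (fun a => cf B i j k p a r) q
  have Y3 := X1 (fun a => cf B i j k p q a) r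
  have Z1 := X2 (fun a => cf B a j k p q r) i
  have Z2 := X2 (fun a => cf B i a k p q r) j
  have Z3 := X2 (fun a => cf B i j a p q r) k
  rw [Y1, Y2, Y3, Z1, Z2, Z3] at e
  linarith

lemma cf_symm1 (B : Module.End ℝ ↥T2) (i j k p q r : Fin 3) :
    cf B i j k p q r = cf B j i k p q r := (B (E p q r)).2 i j k

lemma cf_symm2 (B : Module.End ℝ ↥T2) (i j k p q r : Fin 3) :
    cf B i j k p q r = cf B i j k q p r := by
  have : E p q r = E q p r := by
    apply Subtype.ext; funext i j k; simp only [E]; ring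
  simp only [cf, this]

/-- number of occurrences of `a` -/
def cnt (a i j k p q r : Fin 3) : ℕ := List.count a [i, j, k, p, q, r]

lemma cf_odd (B : Module.End ℝ ↥T2) (hB : Equi B) (a i j k p q r : Fin 3)
    (h : cnt a i j k p q r % 2 = 1) : cf B i j k p q r = 0 := by
  have := cf_refl B hB (fun b => if b = a then -1 else 1)
    (by intro b; split_ifs <;> norm_num) i j k p q r
  simp only [cnt, List.count_cons, List.count_nil, beq_iff_eq] at h
  generalize cf B i j k p q r = x at *
  by_cases h1 : i = a <;> by_cases h2 : j = a <;> by_cases h3 : k = a <;>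
  by_cases h4 : p = a <;> by_cases h5 : q = a <;> by_cases h6 : r = a <;>
  simp only [h1, h2, h3, h4, h5, h6, if_true, if_false] at this h <;>
  first | (exfalso; revert h; decide) | linarith

/-- the fifteen pairings -/
def pr : List (Fin 3 × Fin 3 × Fin 3 × Fin 3 × Fin 3 × Fin 3) :=
  [(0,1,2,0,1,2), (0,1,2,1,0,2),
   (0,1,2,0,2,1), (0,1,2,2,0,1), (1,0,2,0,2,1), (1,0,2,2,0,1),
   (0,0,1,2,2,1),
   (0,0,1,1,2,2), (0,0,1,2,1,2),
   (0,1,0,2,2,1), (1,0,0,2,2,1),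
   (0,1,0,1,2,2), (1,0,0,1,2,2), (0,1,0,2,1,2), (1,0,0,2,1,2)]

lemma norm222 : ∀ i j k p q r : Fin 3, cnt 0 i j k p q r = 2 → cnt 1 i j k p q r = 2 →
    cnt 2 i j k p q r = 2 → ∃ a b c d : Fin 3,
      let σ := Equiv.swap a b * Equiv.swap c d
      (σ i, σ j, σ k, σ p, σ q, σ r) ∈ pr := by
  decide +kernel

lemma norm42 : ∀ i j k p q r : Fin 3,
    cnt 0 i j k p q r % 2 = 1 ∨ cnt 1 i j k p q r % 2 = 1 ∨ cnt 2 i j k p q r % 2 = 1 ∨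
    (cnt 0 i j k p q r = 2 ∧ cnt 1 i j k p q r = 2 ∧ cnt 2 i j k p q r = 2) ∨
    ∃ a b c d : Fin 3,
      let σ := Equiv.swap a b * Equiv.swap c d
      cnt 1 (σ i) (σ j) (σ k) (σ p) (σ q) (σ r) = 0 ∧
      (cnt 0 (σ i) (σ j) (σ k) (σ p) (σ q) (σ r) = 4 ∨
       cnt 0 (σ i) (σ j) (σ k) (σ p) (σ q) (σ r) = 6) := by
  decide +kernel

/-- vanishing of the six basic components -/
def Van (B : Module.End ℝ ↥T2) : Prop :=
  cf B 0 1 2 0 1 2 = 0 ∧ cf B 0 1 2 0 2 1 = 0 ∧ cf B 0 0 1 2 2 1 = 0 ∧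
  cf B 0 0 1 1 2 2 = 0 ∧ cf B 0 1 0 2 2 1 = 0 ∧ cf B 0 1 0 1 2 2 = 0

lemma van222 (B : Module.End ℝ ↥T2) (hB : Equi B) (hV : Van B)
    (i j k p q r : Fin 3) (c0 : cnt 0 i j k p q r = 2) (c1 : cnt 1 i j k p q r = 2)
    (c2 : cnt 2 i j k p q r = 2) : cf B i j k p q r = 0 := by
  obtain ⟨h1, h2, h3, h4, h5, h6⟩ := hV
  obtain ⟨a, b, c, d, h⟩ := norm222 i j k p q r c0 c1 c2
  rw [← cf_perm B hB (Equiv.swap a b * Equiv.swap c d)]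
  simp only [] at h
  generalize (Equiv.swap a b * Equiv.swap c d) = σ at h ⊢
  generalize σ i = i, σ j = j, σ k = k, σ p = p, σ q = q, σ r = r at h ⊢
  simp only [pr, List.mem_cons, Prod.mk.injEq, List.not_mem_nil, or_false] at h
  rcases h with h | h | h | h | h | h | h | h | h | h | h | h | h | h | h <;>
  obtain ⟨rfl, rfl, rfl, rfl, rfl, rfl⟩ := h <;>
  first | assumption | (rw [cf_symm1]; assumption) | (rw [cf_symm2]; assumption) |
    (rw [cf_symm1, cf_symm2]; assumption)

lemma step1 (B : Module.End ℝ ↥T2) (hB : Equi B) (j k p q r : Fin 3)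
    (a1 : sg j * cf B 1 (fl j) k p q r = 0) (a2 : sg k * cf B 1 j (fl k) p q r = 0)
    (a3 : sg p * cf B 1 j k (fl p) q r = 0) (a4 : sg q * cf B 1 j k p (fl q) r = 0)
    (a5 : sg r * cf B 1 j k p q (fl r) = 0) : cf B 0 j k p q r = 0 := by
  have := cf_lie B hB 1 j k p q r
  rw [a1, a2, a3, a4, a5] at this
  simpa [sg, fl] using this

lemma step2 (B : Module.End ℝ ↥T2) (hB : Equi B) (i k p q r : Fin 3)
    (a1 : sg i * cf B (fl i) 1 k p q r = 0) (a2 : sg k * cf B i 1 (fl k) p q r = 0)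
    (a3 : sg p * cf B i 1 k (fl p) q r = 0) (a4 : sg q * cf B i 1 k p (fl q) r = 0)
    (a5 : sg r * cf B i 1 k p q (fl r) = 0) : cf B i 0 k p q r = 0 := by
  rw [cf_symm1]
  apply step1 B hB <;> rw [cf_symm1] <;> assumption

lemma step3 (B : Module.End ℝ ↥T2) (hB : Equi B) (i j p q r : Fin 3)
    (a1 : sg i * cf B (fl i) j 1 p q r = 0) (a2 : sg j * cf B i (fl j) 1 p q r = 0)
    (a3 : sg p * cf B i j 1 (fl p) q r = 0) (a4 : sg q * cf B i j 1 p (fl q) r = 0)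
    (a5 : sg r * cf B i j 1 p q (fl r) = 0) : cf B i j 0 p q r = 0 := by
  have := cf_lie B hB i j 1 p q r
  rw [a1, a2, a3, a4, a5] at this
  simpa [sg, fl] using this

lemma van42 (B : Module.End ℝ ↥T2) (hB : Equi B) (hV : Van B)
    (i j k p q r : Fin 3) (c1 : cnt 1 i j k p q r = 0) (c0 : cnt 0 i j k p q r = 4) :
    cf B i j k p q r = 0 := by
  have V := van222 B hB hV
  have key : ∀ x : Fin 3, x = 0 ∨ x = 1 ∨ x = 2 := by decide
  rcases key i with rfl | rfl | rfl <;> rcases key j with rfl | rfl | rfl <;>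
  rcases key k with rfl | rfl | rfl <;> try (exfalso; revert c1; revert p q r; decide)
  all_goals
  rcases key p with rfl | rfl | rfl <;> rcases key q with rfl | rfl | rfl <;>
  rcases key r with rfl | rfl | rfl <;> try (exfalso; revert c1 c0; decide)
  all_goals
  first
  | apply step1 B hB
  | apply step2 B hB
  | apply step3 B hB
  all_goals
  first
  | (rw [V _ _ _ _ _ _ (by decide) (by decide) (by decide), mul_zero])
  | simp [sg]

lemma van_all (B : Module.End ℝ ↥T2) (hB : Equi B) (hV : Van B)
    (i j k p q r : Fin 3) : cf B i j k p q r = 0 := by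
  have V := van42 B hB hV
  rcases norm42 i j k p q r with h | h | h | h | ⟨a, b, c, d, h⟩
  · exact cf_odd B hB 0 _ _ _ _ _ _ h
  · exact cf_odd B hB 1 _ _ _ _ _ _ h
  · exact cf_odd B hB 2 _ _ _ _ _ _ h
  · exact van222 B hB hV _ _ _ _ _ _ h.1 h.2.1 h.2.2
  · rw [← cf_perm B hB (Equiv.swap a b * Equiv.swap c d)]
    simp only [] at h
    generalize (Equiv.swap a b * Equiv.swap c d) = σ at h ⊢
    generalize σ i = i, σ j = j, σ k = k, σ p = p, σ q = q, σ r = r at h ⊢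
    obtain ⟨h1, h | h⟩ := h
    · exact V _ _ _ _ _ _ h1 h
    · have h0 := List.count_eq_length.mp (show List.count 0 [i, j, k, p, q, r] = 6 from h)
      simp only [List.mem_cons, List.not_mem_nil, or_false, forall_eq_or_imp, forall_eq] at h0
      obtain ⟨rfl, rfl, rfl, rfl, rfl, rfl⟩ := h0
      apply step1 B hB <;> rw [mul_eq_zero] <;> right
      all_goals
        rw [← cf_perm B hB (Equiv.swap 1 2)]
        apply V <;> decide

lemma eq_zero_of_van (B : Module.End ℝ ↥T2) (hB : Equi B) (hV : Van B) : B = 0 := by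
  have : ∀ p q r, B (E p q r) = 0 := by
    intro p q r
    apply Subtype.ext
    funext i j k
    exact van_all B hB hV i j k p q r
  ext1 T
  rw [E_span T]
  simp [this]

/-- The action as an endomorphism of `T2`. -/
def actL (Q : Matrix (Fin 3) (Fin 3) ℝ) : Module.End ℝ ↥T2 where
  toFun T := ⟨act Q T.1, act_mem Q T⟩
  map_add' S T := by
    apply Subtype.ext; funext i j k
    simp [act, mul_add, Finset.sum_add_distrib]
  map_smul' c T := by
    apply Subtype.ext; funext i j k
    simp only [act, Submodule.coe_smul, Pi.smul_apply, smul_eq_mul, Finset.mul_sum,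
      RingHom.id_apply]
    refine Finset.sum_congr rfl fun p _ => Finset.sum_congr rfl fun q _ =>
      Finset.sum_congr rfl fun r _ => by ring

lemma equi_iff (B : Module.End ℝ ↥T2) : Equi B ↔
    ∀ Q : Matrix (Fin 3) (Fin 3) ℝ, Qᵀ * Q = 1 → Q.det = 1 → Commute B (actL Q) := by
  constructor
  · intro h Q h1 h2
    apply LinearMap.ext
    intro T
    apply Subtype.ext
    exact h Q h1 h2 T (act_mem Q T)
  · intro h Q h1 h2 T hT
    exact congrArg Subtype.val (LinearMap.congr_fun (h Q h1 h2) T)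

/-- Projection on the mixed symmetry part. -/
noncomputable def NN : Module.End ℝ ↥T2 where
  toFun T := ⟨fun i j k => (2 * T.1 i j k - T.1 i k j - T.1 j k i) / 3, fun i j k => by
    simp only [T.2 j i k]; ring⟩
  map_add' S T := by apply Subtype.ext; funext i j k; simp; ring
  map_smul' c T := by apply Subtype.ext; funext i j k; simp; ring

/-- Embedding of vectors as `x δ_ij v_k + y (δ_ik v_j + δ_jk v_i)`. -/
def io (x y : ℝ) : (Fin 3 → ℝ) →ₗ[ℝ] ↥T2 where
  toFun v := ⟨fun i j k => x * (dl i j * v k) + y * (dl i k * v j + dl j k * v i),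
    fun i j k => by
      have : dl i j = dl j i := by simp [dl, eq_comm]
      simp only [this]; ring⟩
  map_add' S T := by apply Subtype.ext; funext i j k; simp; ring
  map_smul' c T := by apply Subtype.ext; funext i j k; simp; ring

/-- Combination `x T_ppk + y T_kpp` of traces. -/
def tr (x y : ℝ) : ↥T2 →ₗ[ℝ] (Fin 3 → ℝ) where
  toFun T := fun k => x * (∑ p, T.1 p p k) + y * ∑ p, T.1 k p p
  map_add' S T := by funext k; simp [Finset.sum_add_distrib]; ring
  map_smul' c T := by funext k; simp [← Finset.mul_sum]; ring

lemma tr_io (x y z w : ℝ) : tr x y ∘ₗ io z w = (x * (3 * z + 2 * w) + y * (z + 4 * w)) •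
    LinearMap.id := by
  apply LinearMap.ext; intro v; funext k
  fin_cases k <;> simp [tr, io, dl, Fin.sum_univ_three] <;> ring

lemma NN_io (z w : ℝ) : NN ∘ₗ io z w = io (2 * (z - w) / 3) (-(z - w) / 3) := by
  apply LinearMap.ext; intro v; apply Subtype.ext; funext i j k
  have h1 : dl k j = dl j k := by simp [dl, eq_comm]
  have h2 : dl k i = dl i k := by simp [dl, eq_comm]
  have h3 : dl j i = dl i j := by simp [dl, eq_comm]
  simp only [NN, io, LinearMap.comp_apply, LinearMap.coe_mk, AddHom.coe_mk, h1, h2, h3]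
  ring

lemma tr_NN (x y : ℝ) : tr x y ∘ₗ NN = tr ((2 * x - y) / 3) (-(2 * x - y) / 3) := by
  apply LinearMap.ext; intro T; funext k
  have a : T.1 1 0 = T.1 0 1 := funext (T.2 1 0)
  have b : T.1 2 0 = T.1 0 2 := funext (T.2 2 0)
  have c : T.1 2 1 = T.1 1 2 := funext (T.2 2 1)
  fin_cases k <;> simp [tr, NN, Fin.sum_univ_three, a, b, c] <;> ring

lemma NN_NN : NN * NN = NN := by
  apply LinearMap.ext; intro T; apply Subtype.ext; funext i j k
  simp only [Module.End.mul_apply, NN, LinearMap.coe_mk, AddHom.coe_mk]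
  rw [T.2 j i k, T.2 k i j, T.2 k j i]
  ring

lemma io_zero : io 0 0 = 0 := by
  apply LinearMap.ext; intro v; apply Subtype.ext; funext i j k; simp [io]

lemma tr_zero : tr 0 0 = 0 := by
  apply LinearMap.ext; intro v; funext i; simp [tr]

/-- scaled embeddings -/
def io' : Fin 2 → ((Fin 3 → ℝ) →ₗ[ℝ] ↥T2) := ![io 1 1, io 2 (-1)]
/-- scaled traces -/
noncomputable def tr' : Fin 2 → (↥T2 →ₗ[ℝ] (Fin 3 → ℝ)) := ![tr (1/15) (2/15), tr (1/6) (-1/6)]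
/-- matrix units -/
noncomputable def EE (a b : Fin 2) : Module.End ℝ ↥T2 := io' a ∘ₗ tr' b

lemma tr_io' (b c : Fin 2) : tr' b ∘ₗ io' c = if b = c then LinearMap.id else 0 := by
  fin_cases b <;> fin_cases c <;> simp [tr', io', tr_io] <;> norm_num

lemma EE_mul (a b c d : Fin 2) : EE a b * EE c d = if b = c then EE a d else 0 := by
  have : EE a b * EE c d = io' a ∘ₗ (tr' b ∘ₗ io' c) ∘ₗ tr' d := rfl
  rw [this, tr_io']
  split_ifs
  · rfl
  · simp

lemma NN_EE0 (b : Fin 2) : NN * EE 0 b = 0 := by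
  have : NN * EE 0 b = (NN ∘ₗ io 1 1) ∘ₗ tr' b := rfl
  rw [this, NN_io]; norm_num [io_zero]

lemma NN_EE1 (b : Fin 2) : NN * EE 1 b = EE 1 b := by
  have : NN * EE 1 b = (NN ∘ₗ io 2 (-1)) ∘ₗ tr' b := rfl
  rw [this, NN_io]; norm_num [EE, io']

lemma EE0_NN (a : Fin 2) : EE a 0 * NN = 0 := by
  have : EE a 0 * NN = io' a ∘ₗ (tr (1/15) (2/15) ∘ₗ NN) := rfl
  rw [this, tr_NN]; norm_num [tr_zero]

lemma EE1_NN (a : Fin 2) : EE a 1 * NN = EE a 1 := by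
  have : EE a 1 * NN = io' a ∘ₗ (tr (1/6) (-1/6) ∘ₗ NN) := rfl
  rw [this, tr_NN]; norm_num [EE, tr']

/-- The parametrisation as a linear map. -/
noncomputable def PsiL : (ℝ × ℝ × Matrix (Fin 2) (Fin 2) ℝ) →ₗ[ℝ] Module.End ℝ ↥T2 where
  toFun x := x.1 • 1 + (x.2.1 - x.1) • NN + (x.2.2 0 0 - x.1) • EE 0 0
    + x.2.2 0 1 • EE 0 1 + x.2.2 1 0 • EE 1 0 + (x.2.2 1 1 - x.2.1) • EE 1 1
  map_add' x y := by
    simp only [Prod.fst_add, Prod.snd_add, Matrix.add_apply]; module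
  map_smul' c x := by
    simp only [Prod.smul_fst, Prod.smul_snd, Matrix.smul_apply, RingHom.id_apply, smul_eq_mul]
    module

lemma PsiL_mul (x y) : PsiL (x * y) = PsiL x * PsiL y := by
  simp only [PsiL, LinearMap.coe_mk, AddHom.coe_mk, Prod.fst_mul, Prod.snd_mul, Matrix.mul_apply,
    Fin.sum_univ_two, mul_add, add_mul, smul_mul_smul_comm, one_mul, mul_one,
    NN_NN, EE_mul, NN_EE0, NN_EE1, EE0_NN, EE1_NN]
  simp
  module

lemma PsiL_one : PsiL 1 = 1 := by
  simp [PsiL]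

/-- The parametrisation as an algebra homomorphism. -/
noncomputable def Psi : (ℝ × ℝ × Matrix (Fin 2) (Fin 2) ℝ) →ₐ[ℝ] Module.End ℝ ↥T2 :=
  AlgHom.ofLinearMap PsiL PsiL_one PsiL_mul

lemma NN_comm (Q : Matrix (Fin 3) (Fin 3) ℝ) : Commute NN (actL Q) := by
  apply LinearMap.ext; intro T; apply Subtype.ext; funext i j k
  have s1 : act Q T.1 i k j = ∑ p, ∑ q, ∑ r, Q i p * Q j q * Q k r * T.1 p r q := by
    simp only [act]
    refine Finset.sum_congr rfl fun p _ => ?_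
    rw [Finset.sum_comm]
    refine Finset.sum_congr rfl fun q _ => Finset.sum_congr rfl fun r _ => by ring
  have s2 : act Q T.1 j k i = ∑ p, ∑ q, ∑ r, Q i p * Q j q * Q k r * T.1 q r p := by
    simp only [act, Fin.sum_univ_three]
    ring
  simp only [Module.End.mul_apply, NN, actL, LinearMap.coe_mk, AddHom.coe_mk, s1, s2]
  simp only [act, sub_div, mul_sub, Finset.sum_sub_distrib, Finset.mul_sum, Finset.sum_div]
  congr 1
  · congr 1
    · refine Finset.sum_congr rfl fun p _ => Finset.sum_congr rfl fun q _ =>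
        Finset.sum_congr rfl fun r _ => by ring
    · refine Finset.sum_congr rfl fun p _ => Finset.sum_congr rfl fun q _ =>
        Finset.sum_congr rfl fun r _ => by ring
  · refine Finset.sum_congr rfl fun p _ => Finset.sum_congr rfl fun q _ =>
      Finset.sum_congr rfl fun r _ => by ring

lemma tr_comm (x y : ℝ) (Q : Matrix (Fin 3) (Fin 3) ℝ) (h1 : Qᵀ * Q = 1) (T : T2) :
    tr x y (actL Q T) = Q *ᵥ (tr x y T) := by
  have h : ∀ a b, ∑ p, Q p a * Q p b = dl a b := by
    intro a b
    have := congrFun (congrFun h1 a) b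
    simpa [Matrix.mul_apply, Matrix.one_apply, dl] using this
  funext k
  have e1 : ∑ p, act Q T.1 p p k = ∑ c, Q k c * ∑ a, T.1 a a c := by
    have : ∑ p, act Q T.1 p p k = ∑ a, ∑ b, (∑ p, Q p a * Q p b) * ∑ c, Q k c * T.1 a b c := by
      simp only [act, Fin.sum_univ_three]; ring
    rw [this]
    simp only [h, dl, Fin.sum_univ_three]
    simp
    ring
  have e2 : ∑ p, act Q T.1 k p p = ∑ c, Q k c * ∑ a, T.1 c a a := by
    have : ∑ p, act Q T.1 k p p = ∑ a, ∑ b, (∑ p, Q p a * Q p b) * ∑ c, Q k c * T.1 c a b := by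
      simp only [act, Fin.sum_univ_three]; ring
    rw [this]
    simp only [h, dl, Fin.sum_univ_three]
    simp
    ring
  change x * (∑ p, act Q T.1 p p k) + y * (∑ p, act Q T.1 k p p) = _
  rw [e1, e2]
  simp only [tr, LinearMap.coe_mk, AddHom.coe_mk, Matrix.mulVec, dotProduct,
    mul_add, Finset.sum_add_distrib, Finset.mul_sum]
  congr 1 <;> refine Finset.sum_congr rfl fun p _ => Finset.sum_congr rfl fun q _ => by ring

lemma io_comm (x y : ℝ) (Q : Matrix (Fin 3) (Fin 3) ℝ) (h1 : Qᵀ * Q = 1) (v : Fin 3 → ℝ) :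
    io x y (Q *ᵥ v) = actL Q (io x y v) := by
  have h : ∀ a b, dl a b = ∑ p, Q a p * Q b p := by
    intro a b
    have h2 : Q * Qᵀ = 1 := mul_eq_one_comm.mp h1
    have := congrFun (congrFun h2 a) b
    simpa [Matrix.mul_apply, Matrix.one_apply, dl] using this.symm
  apply Subtype.ext; funext i j k
  have e : ∀ p q r, (io x y v).1 p q r =
    x * (dl p q * v r) + y * (dl p r * v q + dl q r * v p) := fun _ _ _ => rfl
  have e' : (io x y (Q *ᵥ v)).1 i j k = x * (dl i j * (Q *ᵥ v) k) +
    y * (dl i k * (Q *ᵥ v) j + dl j k * (Q *ᵥ v) i) := rfl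
  have e2 : (actL Q (io x y v)).1 i j k = act Q (io x y v).1 i j k := rfl
  rw [e', e2, h i j, h i k, h j k]
  simp only [act, e, Matrix.mulVec, dotProduct, Fin.sum_univ_three, dl]
  simp
  ring

lemma EE_comm (a b : Fin 2) (Q : Matrix (Fin 3) (Fin 3) ℝ) (h1 : Qᵀ * Q = 1) :
    Commute (EE a b) (actL Q) := by
  apply LinearMap.ext; intro T
  simp only [Module.End.mul_apply, EE, LinearMap.comp_apply]
  have t : tr' b (actL Q T) = Q *ᵥ (tr' b T) := by
    fin_cases b <;> exact tr_comm _ _ Q h1 T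
  rw [t]
  fin_cases a <;> exact io_comm _ _ Q h1 _

lemma Psi_equi (x) : Equi (Psi x) := by
  rw [equi_iff]
  intro Q h1 _
  have n := NN_comm Q
  have e := fun a b => EE_comm a b Q h1
  change Commute (PsiL x) _
  simp only [PsiL, LinearMap.coe_mk, AddHom.coe_mk]
  refine ((((Commute.add_left ?_ ?_).add_left ?_).add_left ?_).add_left ?_).add_left ?_
  · exact (Commute.one_left _).smul_left _
  · exact n.smul_left _
  all_goals exact (e _ _).smul_left _

lemma equi_sub (A B : Module.End ℝ ↥T2) (hA : Equi A) (hB : Equi B) : Equi (A - B) := by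
  have : A - B = A + (-1 : ℝ) • B := by module
  rw [this]
  rw [equi_iff] at *
  exact fun Q h1 h2 => (hA Q h1 h2).add_left ((hB Q h1 h2).smul_left _)

lemma cf_sub (A B : Module.End ℝ ↥T2) (i j k p q r : Fin 3) :
    cf (A - B) i j k p q r = cf A i j k p q r - cf B i j k p q r := rfl

lemma cf_Psi (x) (i j k p q r : Fin 3) : cf (Psi x) i j k p q r =
    x.1 * cf 1 i j k p q r + (x.2.1 - x.1) * cf NN i j k p q r
    + (x.2.2 0 0 - x.1) * cf (EE 0 0) i j k p q r + x.2.2 0 1 * cf (EE 0 1) i j k p q r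
    + x.2.2 1 0 * cf (EE 1 0) i j k p q r + (x.2.2 1 1 - x.2.1) * cf (EE 1 1) i j k p q r := rfl

lemma cf_one (i j k p q r : Fin 3) :
    cf 1 i j k p q r = (dl i p * dl j q + dl i q * dl j p) * dl k r := rfl

lemma cf_NN (i j k p q r : Fin 3) :
    cf NN i j k p q r = (2 * cf 1 i j k p q r - cf 1 i k j p q r - cf 1 j k i p q r) / 3 := rfl

lemma cf_EE (i j k p q r : Fin 3) (x y z w : ℝ) :
    cf (io x y ∘ₗ tr z w) i j k p q r =
      x * (dl i j * tr z w (E p q r) k) + y * (dl i k * tr z w (E p q r) j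
        + dl j k * tr z w (E p q r) i) := rfl

lemma tr_E (z w : ℝ) (p q r k : Fin 3) : tr z w (E p q r) k =
    z * (∑ a, cf 1 a a k p q r) + w * ∑ a, cf 1 k a a p q r := rfl

lemma EE00 : EE 0 0 = io 1 1 ∘ₗ tr (1/15) (2/15) := rfl
lemma EE01 : EE 0 1 = io 1 1 ∘ₗ tr (1/6) (-1/6) := rfl
lemma EE10 : EE 1 0 = io 2 (-1) ∘ₗ tr (1/15) (2/15) := rfl
lemma EE11 : EE 1 1 = io 2 (-1) ∘ₗ tr (1/6) (-1/6) := rfl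

lemma cf_vals (a b m n u v : ℝ) :
    cf (Psi (a, b, !![m, n; u, v])) 0 1 2 0 1 2 = (a + 2 * b) / 3 ∧
    cf (Psi (a, b, !![m, n; u, v])) 0 1 2 0 2 1 = (a - b) / 3 ∧
    cf (Psi (a, b, !![m, n; u, v])) 0 0 1 2 2 1 =
      2 * ((m - a) / 15 + 2 * ((v - b) / 6) + n / 6 + 2 * (u / 15)) ∧
    cf (Psi (a, b, !![m, n; u, v])) 0 0 1 1 2 2 =
      2 * ((m - a) / 15) - 2 * ((v - b) / 6) - n / 6 + 4 * (u / 15) ∧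
    cf (Psi (a, b, !![m, n; u, v])) 0 1 0 2 2 1 =
      2 * ((m - a) / 15 - ((v - b) / 6) + n / 6 - (u / 15)) ∧
    cf (Psi (a, b, !![m, n; u, v])) 0 1 0 1 2 2 =
      2 * ((m - a) / 15) + ((v - b) / 6) - n / 6 - 2 * (u / 15) := by
  refine ⟨?_, ?_, ?_, ?_, ?_, ?_⟩ <;>
  simp [cf_Psi, cf_NN, EE00, EE01, EE10, EE11, cf_EE, tr_E, cf_one, dl, Fin.sum_univ_three] <;>
  ring

lemma Psi_inj : Function.Injective Psi := by
  rw [injective_iff_map_eq_zero]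
  rintro ⟨a, b, M⟩ h
  obtain ⟨m, n, u, v, rfl⟩ : ∃ m n u v, M = !![m, n; u, v] :=
    ⟨_, _, _, _, Matrix.eta_fin_two M⟩
  have H := cf_vals a b m n u v
  rw [h] at H
  have z : ∀ i j k p q r, cf 0 i j k p q r = 0 := fun _ _ _ _ _ _ => rfl
  simp only [z] at H
  obtain ⟨h1, h2, h3, h4, h5, h6⟩ := H
  have ha : a = 0 := by linarith
  have hb : b = 0 := by linarith
  have hm : m = 0 := by linarith
  have hn : n = 0 := by linarith
  have hu : u = 0 := by linarith
  have hv : v = 0 := by linarith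
  subst ha hb hm hn hu hv
  simp only [Prod.mk_eq_zero, true_and]
  ext i j; fin_cases i <;> fin_cases j <;> rfl

lemma mem_range_of_equi (A : Module.End ℝ ↥T2) (hA : Equi A) : ∃ x, Psi x = A := by
  obtain ⟨o1, h1⟩ : ∃ o, o = cf A 0 1 2 0 1 2 := ⟨_, rfl⟩
  obtain ⟨o2, h2⟩ : ∃ o, o = cf A 0 1 2 0 2 1 := ⟨_, rfl⟩
  obtain ⟨o3, h3⟩ : ∃ o, o = cf A 0 0 1 2 2 1 / 2 := ⟨_, rfl⟩
  obtain ⟨o4, h4⟩ : ∃ o, o = cf A 0 0 1 1 2 2 := ⟨_, rfl⟩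
  obtain ⟨o5, h5⟩ : ∃ o, o = cf A 0 1 0 2 2 1 / 2 := ⟨_, rfl⟩
  obtain ⟨o6, h6⟩ : ∃ o, o = cf A 0 1 0 1 2 2 := ⟨_, rfl⟩
  let x : ℝ × ℝ × Matrix (Fin 2) (Fin 2) ℝ := (o1 + 2 * o2, o1 - o2,
    !![o1 + 2 * o2 + 15 * ((o3 + o4) + 2 * (o5 + o6)) / 9,
       6 * ((2 * o3 - o4) + 2 * (2 * o5 - o6)) / 9;
       15 * ((o3 + o4) - (o5 + o6)) / 9,
       o1 - o2 + 6 * ((2 * o3 - o4) - (2 * o5 - o6)) / 9])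
  refine ⟨x, ?_⟩
  have : A - Psi x = 0 := by
    apply eq_zero_of_van _ (equi_sub _ _ hA (Psi_equi x))
    have H := cf_vals x.1 x.2.1 (x.2.2 0 0) (x.2.2 0 1) (x.2.2 1 0) (x.2.2 1 1)
    rw [← Matrix.eta_fin_two] at H
    obtain ⟨g1, g2, g3, g4, g5, g6⟩ := H
    simp [x] at g1 g2 g3 g4 g5 g6
    refine ⟨?_, ?_, ?_, ?_, ?_, ?_⟩ <;> rw [cf_sub] <;> linarith
  exact (sub_eq_zero.mp this).symm

theorem isotropic_second_order_elasticity_algebra :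
    ∃ S : Subalgebra ℝ (Module.End ℝ ↥T2),
      (∀ A : Module.End ℝ ↥T2, A ∈ S ↔
        (∀ Q : Matrix (Fin 3) (Fin 3) ℝ, Qᵀ * Q = 1 → Q.det = 1 →
          ∀ (T : T2) (h : act Q (T : Fin 3 → Fin 3 → Fin 3 → ℝ) ∈ T2),
            ((A ⟨act Q (T : Fin 3 → Fin 3 → Fin 3 → ℝ), h⟩ : T2) : Fin 3 → Fin 3 → Fin 3 → ℝ)
              = act Q ((A T : T2) : Fin 3 → Fin 3 → Fin 3 → ℝ))) ∧
      Nonempty (↥S ≃ₐ[ℝ] (ℝ × ℝ × Matrix (Fin 2) (Fin 2) ℝ)) := by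
  refine ⟨Psi.range, ?_, ⟨(AlgEquiv.ofInjective Psi Psi_inj).symm⟩⟩
  intro A
  constructor
  · rintro ⟨x, rfl⟩
    exact Psi_equi x
  · intro h
    exact mem_range_of_equi A h
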